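/- The plethysm h_k ∘ e₂ equals the sum of Schur functions s_{(2α)'} over all partitions α of k. -/

import Mathlib

open MvPolynomial Finset

/-- The ring of symmetric functions (with rational coefficients), realized as the free
commutative `ℚ`-algebra on the complete homogeneous symmetric functions `h₁, h₂, …`,
where the variable `n : ℕ` corresponds to `h_{n+1}`. -/
abbrev SymFn : Type := MvPolynomial ℕ ℚ

/-- The complete homogeneous symmetric function `h_n`, with `h_n = 0` for `n < 0`
and `h_0 = 1`. -/
noncomputable def hh (n : ℤ) : SymFn :=
  if n < 0 then 0 else if n = 0 then 1 else MvPolynomial.X (n.toNat - 1)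

/-- The power sum symmetric functions, defined from the `h`'s by Newton's identities:
`p_k = k h_k - ∑_{i=1}^{k-1} h_i p_{k-i}`. -/
noncomputable def pp : ℕ → SymFn
  | 0 => 0
  | (k+1) => ((k : ℚ) + 1) • hh (k+1) - ∑ i ∈ Finset.range k, hh (i+1) * pp (k - i)
  decreasing_by exact Nat.lt_succ_of_le (Nat.sub_le _ _)

/-- `h_m` written as a polynomial in the power sums (the variable `j` stands for `p_{j+1}`),
via the recursion `m h_m = ∑_{i=1}^{m} p_i h_{m-i}`. -/
noncomputable def hInP : ℕ → MvPolynomial ℕ ℚ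
  | 0 => 1
  | (m+1) => ((m : ℚ) + 1)⁻¹ •
      ∑ i ∈ Finset.range (m+1), MvPolynomial.X i * hInP (m - i)
  decreasing_by exact Nat.lt_succ_of_le (Nat.sub_le _ _)

/-- The `k`-th Adams operation: the algebra endomorphism of `SymFn` determined by
`p_m ↦ p_{k m}` on power sums. -/
noncomputable def adams (k : ℕ) : SymFn →ₐ[ℚ] SymFn :=
  aeval fun m => (aeval fun j => pp (k * (j+1))) (hInP (m+1))

/-- The plethysm `h_k ∘ g`, via the recursion
`k (h_k ∘ g) = ∑_{i=1}^{k} (p_i ∘ g) (h_{k-i} ∘ g)`, where `p_i ∘ g = adams i g`. -/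
noncomputable def hPleth (g : SymFn) : ℕ → SymFn
  | 0 => 1
  | (k+1) => ((k : ℚ) + 1)⁻¹ •
      ∑ i ∈ Finset.range (k+1), adams (i+1) g * hPleth g (k - i)
  decreasing_by exact Nat.lt_succ_of_le (Nat.sub_le _ _)

/-- The (outer) plethysm `f ∘ g` of symmetric functions: the algebra homomorphism
in the left argument sending `h_k ↦ h_k ∘ g`. -/
noncomputable def pleth (f g : SymFn) : SymFn := aeval (fun m => hPleth g (m+1)) f

/-- The elementary symmetric functions, via `e_k = ∑_{i=1}^{k} (-1)^{i-1} h_i e_{k-i}`. -/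
noncomputable def ee : ℕ → SymFn
  | 0 => 1
  | (k+1) => ∑ i ∈ Finset.range (k+1), ((-1 : ℚ))^i • (hh (i+1) * ee (k - i))
  decreasing_by exact Nat.lt_succ_of_le (Nat.sub_le _ _)

/-- The parts of a multiset, as a weakly decreasing list. -/
def sortedParts (m : Multiset ℕ) : List ℕ := (m.sort (· ≤ ·)).reverse

/-- The Schur function `s_m`, via the Jacobi–Trudi determinant
`s_λ = det (h_{λ_i + j - i})`. -/
noncomputable def schur (m : Multiset ℕ) : SymFn :=
  Matrix.det (Matrix.of fun i j : Fin (Multiset.card m) =>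
    hh (((sortedParts m).getD i 0 : ℤ) + (j : ℤ) - (i : ℤ)))

/-- A multiset of naturals is a partition when all its parts are positive. -/
def IsPartition (m : Multiset ℕ) : Prop := 0 ∉ m

/-- A strict partition: positive, pairwise distinct parts. -/
def IsStrictPartition (m : Multiset ℕ) : Prop := 0 ∉ m ∧ m.Nodup

/-- The first (largest) part `λ₁` of a partition. -/
def firstPart (m : Multiset ℕ) : ℕ := m.sup

/-- The size `|λ|` of a partition. -/
def psize (m : Multiset ℕ) : ℕ := m.sum

/-- The conjugate (transposed) partition. -/
def conj (m : Multiset ℕ) : Multiset ℕ :=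
  ((List.range m.sup).map fun i => Multiset.card (m.filter fun x => i < x) : List ℕ)

/-- The partition `ν[N] = (N - |ν|, ν₁, ν₂, …)` (valid when `N ≥ |ν| + ν₁`). -/
def padded (ν : Multiset ℕ) (N : ℕ) : Multiset ℕ := (N - ν.sum) ::ₘ ν

/-- `c` is the expansion of `f` in the basis of Schur functions indexed by partitions. -/
def SchurExpansion (f : SymFn) (c : Multiset ℕ →₀ ℚ) : Prop :=
  (∀ κ ∈ c.support, IsPartition κ) ∧ f = c.sum fun κ a => a • schur κ

/-- `Φ` of a Schur expansion: the largest first part of a partition occurring in it. -/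
def Phi (c : Multiset ℕ →₀ ℚ) : ℕ := c.support.sup firstPart

/-- The partition `2α`, doubling every part. -/
def double (m : Multiset ℕ) : Multiset ℕ := m.map (2 * ·)

/-- For a strict partition `β = (β₁ > β₂ > … > β_r > 0)`, the partition `Γ(β)` with
Frobenius coordinates `(β₁ - 1, …, β_r - 1 | β₁, …, β_r)`. -/
def gammaFrob (β : Multiset ℕ) : Multiset ℕ :=
  let b := sortedParts β
  let r := b.length
  (((List.range r).map fun i => b.getD i 0 + i)
    ++ ((List.range (b.getD 0 0 + 1 - r)).map fun t =>
        ((List.range r).filter fun j => r + t ≤ b.getD j 0 + j).length) : List ℕ)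


noncomputable section HK1

variable {R : Type*} [CommRing R]

def geo (y : R) : PowerSeries R := PowerSeries.mk (fun n => y ^ n)

theorem geo_mul (y : R) : geo y * (1 - PowerSeries.C y * PowerSeries.X) = 1 := by
  ext n
  rw [mul_sub, mul_one, map_sub, mul_comm, mul_assoc, PowerSeries.coeff_C_mul]
  cases n with
  | zero => simp [geo]
  | succ n => simp [geo, PowerSeries.coeff_succ_X_mul, PowerSeries.coeff_one, pow_succ']

theorem deriv_geo (y : R) : PowerSeries.derivative R (geo y) = PowerSeries.C y * geo y * geo y := by
  have h := geo_mul y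
  have h2 := congrArg (PowerSeries.derivative R) h
  simp only [Derivation.leibniz, map_sub, smul_eq_mul] at h2
  have hC : PowerSeries.derivative R (PowerSeries.C y) = 0 := by
    ext n; simp [PowerSeries.coeff_derivative, PowerSeries.coeff_C]
  have hX : PowerSeries.derivative R (PowerSeries.X : PowerSeries R) = 1 := by
    ext n; simp [PowerSeries.coeff_derivative, PowerSeries.coeff_X, PowerSeries.coeff_one]
  rw [hC, hX] at h2
  simp at h2
  linear_combination geo y * h2 - PowerSeries.derivative R (geo y) * h

def GG {ι : Type*} (S : Finset ι) (y : ι → R) : PowerSeries R := ∏ s ∈ S, geo (y s)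

theorem GG_zero {ι : Type*} (S : Finset ι) (y : ι → R) : PowerSeries.coeff 0 (GG S y) = 1 := by
  simp [GG, geo, map_prod]

theorem deriv_GG {ι : Type*} (S : Finset ι) (y : ι → R) :
    PowerSeries.derivative R (GG S y) = (∑ s ∈ S, PowerSeries.C (y s) * geo (y s)) * GG S y := by
  classical
  induction S using Finset.induction_on with
  | empty => simp [GG]
  | insert a S ha ih =>
    have h : GG (insert a S) y = geo (y a) * GG S y := by simp [GG, Finset.prod_insert ha]
    rw [h, Derivation.leibniz, ih, Finset.sum_insert ha, deriv_geo]
    simp only [smul_eq_mul]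
    ring

theorem newton_GG {ι : Type*} (S : Finset ι) (y : ι → R) (k : ℕ) :
    ((k : R) + 1) * PowerSeries.coeff (k+1) (GG S y) =
      ∑ i ∈ Finset.range (k+1), (∑ s ∈ S, y s ^ (i+1)) * PowerSeries.coeff (k - i) (GG S y) := by
  have h := congrArg (PowerSeries.coeff k) (deriv_GG S y)
  rw [PowerSeries.coeff_derivative, PowerSeries.coeff_mul,
    Finset.Nat.sum_antidiagonal_eq_sum_range_succ_mk] at h
  rw [mul_comm, h]
  refine Finset.sum_congr rfl fun i _ => ?_
  simp [geo, pow_succ']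

theorem GG_mul {ι : Type*} (S : Finset ι) (y : ι → R) :
    GG S y * ∏ s ∈ S, (1 - PowerSeries.C (y s) * PowerSeries.X) = 1 := by
  rw [GG, ← Finset.prod_mul_distrib]
  exact Finset.prod_eq_one fun s _ => geo_mul _

end HK1

noncomputable section HK2

variable (N : ℕ)

abbrev RR : Type := MvPolynomial (Fin N) ℚ

def hser : PowerSeries (RR N) := GG Finset.univ (fun i : Fin N => (X i : RR N))

def hc (n : ℕ) : RR N := PowerSeries.coeff n (hser N)

def hcz (n : ℤ) : RR N := if n < 0 then 0 else hc N n.toNat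

theorem hc_zero : hc N 0 = 1 := GG_zero _ _

def phi : SymFn →ₐ[ℚ] RR N := aeval fun n => hc N (n+1)

theorem phi_hh (n : ℤ) : phi N (hh n) = hcz N n := by
  unfold hh hcz
  split_ifs with h1 h2
  · simp
  · subst h2; simp [hc_zero]
  · rw [phi, aeval_X]
    congr 1; omega

theorem phi_hh_nat (n : ℕ) : phi N (hh n) = hc N n := by
  rw [phi_hh, hcz]; simp

def ps (k : ℕ) : RR N := ∑ i : Fin N, X i ^ k

theorem newton_hc (k : ℕ) : ((k : RR N) + 1) * hc N (k+1) =
      ∑ i ∈ Finset.range (k+1), ps N (i+1) * hc N (k - i) := newton_GG _ _ k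

theorem phi_pp (k : ℕ) : phi N (pp (k+1)) = ps N (k+1) := by
  induction k using Nat.strong_induction_on with
  | _ k ih =>
    have h := newton_hc N k
    rw [Finset.sum_range_succ, Nat.sub_self, hc_zero, mul_one] at h
    rw [pp, map_sub, map_sum, map_smul,
      show (k : ℤ) + 1 = ((k + 1 : ℕ) : ℤ) by push_cast; rfl, phi_hh_nat]
    have h2 : ∑ i ∈ range k, phi N (hh (i+1) * pp (k - i)) =
        ∑ i ∈ range k, ps N (i+1) * hc N (k - i) := by
      rw [← Finset.sum_range_reflect]
      refine Finset.sum_congr rfl fun i hi => ?_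
      rw [Finset.mem_range] at hi
      rw [map_mul]
      have e1 : k - (k - 1 - i) = i + 1 := by omega
      have e2 : ((k - 1 - i : ℕ) : ℤ) + 1 = ((k - i : ℕ) : ℤ) := by omega
      rw [e1, e2, ih i hi, phi_hh_nat, mul_comm]
    rw [h2, Algebra.smul_def]
    have h3 : algebraMap ℚ (RR N) ((k:ℚ)+1) = (k : RR N) + 1 := by simp
    rw [h3, h]
    ring

def ys (s : Finset (Fin N)) : RR N := ∏ i ∈ s, X i

abbrev S2 : Finset (Finset (Fin N)) := Finset.powersetCard 2 Finset.univ

theorem two_e2 (k : ℕ) : 2 * ∑ s ∈ S2 N, ys N s ^ k = ps N k * ps N k - ps N (2 * k) := by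
  have h := mul_esymm_eq_sum (Fin N) ℚ 2
  have e : (antidiagonal 2).filter (fun a : ℕ × ℕ => a.1 < 2) = {(0,2),(1,1)} := by decide
  rw [e, Finset.sum_pair (by decide)] at h
  have h2 := congrArg (aeval (fun i : Fin N => (X i : RR N) ^ k)) h
  simp [psum, esymm, map_sum, map_prod, powersetCard_one] at h2
  have h3 : (bind₁ fun i : Fin N => (X i : RR N) ^ k) 2 = 2 := map_ofNat _ 2
  rw [h3] at h2
  simp only [ys, ← Finset.prod_pow, ps, mul_comm 2 k, pow_mul]
  linear_combination h2

theorem ee_two : ee 2 = hh 1 * hh 1 - hh 2 := by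
  simp [ee, Finset.sum_range_succ]
  ring

theorem adams_e2 (n : ℕ) : adams n (ee 2) = (1/2 : ℚ) • (pp n * pp n - pp (2 * n)) := by
  have h1 : hh 1 = X 0 := by simp [hh]
  have h2 : hh 2 = X 1 := by simp [hh]
  have i1 : hInP 1 = X 0 := by simp [hInP]
  have i2 : hInP 2 = (1/2 : ℚ) • (X 0 * X 0 + X 1) := by
    rw [hInP]
    simp [Finset.sum_range_succ, i1, hInP]
    norm_num
  rw [ee_two, h1, h2, map_sub, map_mul, adams, aeval_X, aeval_X, i1, i2]
  simp only [map_smul, map_add, map_mul, aeval_X]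
  simp only [Algebra.smul_def]
  have e : algebraMap ℚ SymFn (1/2) + algebraMap ℚ SymFn (1/2) = 1 := by
    rw [← map_add]; norm_num
  have : n * (1 + 1) = 2 * n := by ring
  simp [this] at e ⊢
  linear_combination (-pp n * pp n) * e

def gs (k : ℕ) : RR N := PowerSeries.coeff k (GG (S2 N) (ys N))

theorem phi_adams (i : ℕ) : phi N (adams (i+1) (ee 2)) = ∑ s ∈ S2 N, ys N s ^ (i+1) := by
  rw [adams_e2, map_smul, map_sub, map_mul, phi_pp]
  have e : 2 * (i+1) = (2 * i + 1) + 1 := by ring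
  have h := two_e2 N (i+1)
  rw [e] at h ⊢
  rw [phi_pp, ← h, Algebra.smul_def, ← mul_assoc]
  have : algebraMap ℚ (RR N) (1/2) * 2 = 1 := by
    rw [← map_ofNat (algebraMap ℚ (RR N)) 2, ← map_mul]; norm_num
  rw [this, one_mul]

theorem phi_hPleth (k : ℕ) : phi N (hPleth (ee 2) k) = gs N k := by
  induction k using Nat.strong_induction_on with
  | _ k ih =>
    cases k with
    | zero => simp [hPleth, gs, GG_zero]
    | succ k =>
      rw [hPleth, map_smul, map_sum]
      have h := newton_GG (S2 N) (ys N) k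
      have h2 : ∑ i ∈ range (k+1), phi N (adams (i+1) (ee 2) * hPleth (ee 2) (k - i)) =
        ((k : RR N) + 1) * gs N (k+1) := by
        rw [gs, h]
        refine Finset.sum_congr rfl fun i hi => ?_
        rw [map_mul, phi_adams, ih _ (by omega)]
        rfl
      rw [h2, Algebra.smul_def, ← mul_assoc]
      have h3 : (k : RR N) + 1 = algebraMap ℚ (RR N) ((k:ℚ)+1) := by simp
      rw [h3, ← map_mul, inv_mul_cancel₀ (by positivity), map_one, one_mul]

theorem phi_pleth (k : ℕ) : phi N (pleth (hh k) (ee 2)) = gs N k := by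
  rw [← phi_hPleth]
  congr 1
  cases k with
  | zero => simp [pleth, hh, hPleth]
  | succ k =>
    have : hh ((k+1 : ℕ) : ℤ) = X k := by
      unfold hh
      rw [if_neg (by omega), if_neg (by omega)]; congr 1
    rw [this, pleth, aeval_X]

end HK2

noncomputable section HK3

variable (N : ℕ)

/-- product of `1 - x_i T`. -/
def eser (S : Finset (Fin N)) : PowerSeries (RR N) :=
  ∏ i ∈ S, (1 - PowerSeries.C (X i : RR N) * PowerSeries.X)

theorem coeff_eser (S : Finset (Fin N)) (r : ℕ) : PowerSeries.coeff r (eser N S) =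
    (-1) ^ r * ∑ t ∈ powersetCard r S, ∏ i ∈ t, (X i : RR N) := by
  have h : eser N S = ∑ t ∈ S.powerset, PowerSeries.C ((-1) ^ #t * ∏ i ∈ t, (X i : RR N)) *
      PowerSeries.X ^ #t := by
    rw [eser]
    have : ∀ i : Fin N, (1 - PowerSeries.C (X i : RR N) * PowerSeries.X) =
      1 + PowerSeries.C (-X i : RR N) * PowerSeries.X := by intro i; simp [sub_eq_add_neg]
    simp_rw [this]
    rw [Finset.prod_one_add]
    refine Finset.sum_congr rfl fun t _ => ?_
    rw [Finset.prod_mul_distrib, Finset.prod_const, ← map_prod, Finset.prod_neg]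
  rw [h, map_sum]
  simp only [PowerSeries.coeff_C_mul, PowerSeries.coeff_X_pow]
  rw [Finset.powersetCard_eq_filter, Finset.mul_sum, Finset.sum_filter]
  refine Finset.sum_congr rfl fun t _ => ?_
  by_cases h : #t = r
  · simp [h]
  · rw [if_neg (Ne.symm h), if_neg h, mul_zero]

/-- `∑ (-1)^i e_i h_{k-i} = 0`. -/
theorem e_h (k : ℕ) : ∑ i ∈ range (k + 2), (-1) ^ i * esymm (Fin N) ℚ i * hc N (k + 1 - i) = 0 := by
  have h := GG_mul Finset.univ (fun i : Fin N => (X i : RR N))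
  have h2 := congrArg (PowerSeries.coeff (k+1)) h
  rw [mul_comm, PowerSeries.coeff_mul, Finset.Nat.sum_antidiagonal_eq_sum_range_succ_mk] at h2
  simp only [PowerSeries.coeff_one] at h2
  rw [if_neg (by omega)] at h2
  rw [← h2]
  refine Finset.sum_congr rfl fun i _ => ?_
  change _ = PowerSeries.coeff i (eser N univ) * _
  rw [coeff_eser]; rfl

theorem hser_symm (e : Equiv.Perm (Fin N)) :
    PowerSeries.map (rename e : RR N →ₐ[ℚ] RR N).toRingHom (hser N) = hser N := by
  unfold hser GG
  rw [map_prod]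
  refine Fintype.prod_equiv e _ _ fun i => ?_
  ext1 n
  simp [geo]

theorem hc_symm (n : ℕ) : (hc N n).IsSymmetric := by
  intro e
  have h := congrArg (PowerSeries.coeff n) (hser_symm N e)
  simpa [hc] using h

def hsub : MvPolynomial (Fin N) ℚ →ₐ[ℚ] symmetricSubalgebra (Fin N) ℚ :=
  aeval fun i => ⟨hc N (i+1), hc_symm N _⟩

def esub (n : ℕ) : symmetricSubalgebra (Fin N) ℚ := ⟨esymm (Fin N) ℚ n, esymm_isSymmetric _ _ _⟩

theorem esub_mem (n : ℕ) (hn : n ≤ N) : esub N n ∈ (hsub N).range := by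
  induction n using Nat.strong_induction_on with
  | _ n ih =>
    cases n with
    | zero =>
      have : esub N 0 = 1 := by ext1; simp [esub]
      rw [this]; exact one_mem _
    | succ k =>
      let hs : ℕ → symmetricSubalgebra (Fin N) ℚ := fun n => ⟨hc N n, hc_symm N n⟩
      have hsm : ∀ j, j < N → hs (j+1) ∈ (hsub N).range := fun j hj =>
        ⟨X ⟨j, hj⟩, by simp [hsub, hs]⟩
      have h : ∑ i ∈ range (k + 2), (-1) ^ i * esub N i * hs (k + 1 - i) = 0 := by
        ext1
        simpa [esub, hs] using e_h N k
      rw [Finset.sum_range_succ] at h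
      have h0 : hs (k + 1 - (k + 1)) = 1 := by ext1; simp [hs, hc_zero]
      rw [h0, mul_one] at h
      have hm : (-1 * -1 : symmetricSubalgebra (Fin N) ℚ) = 1 := by ext1; simp
      have h1 : esub N (k+1) = (-1) ^ (k+1) * -∑ i ∈ range (k + 1), (-1) ^ i * esub N i * hs (k + 1 - i) := by
        rw [neg_eq_of_add_eq_zero_right h, ← mul_assoc, ← mul_pow, hm, one_pow, one_mul]
      rw [h1]
      have hneg : ∀ j, ((-1)^j : symmetricSubalgebra (Fin N) ℚ) ∈ (hsub N).range :=
        fun j => pow_mem (neg_mem (one_mem _)) _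
      refine mul_mem (hneg _) (neg_mem (sum_mem fun i hi => ?_))
      rw [Finset.mem_range] at hi
      refine mul_mem (mul_mem (hneg _) (ih i (by omega) (by omega))) ?_
      have : k + 1 - i = (k - i) + 1 := by omega
      rw [this]
      exact hsm _ (by omega)

theorem hsub_surj : Function.Surjective (hsub N) := by
  rw [← AlgHom.range_eq_top, eq_top_iff]
  intro x _
  obtain ⟨p, rfl⟩ := (esymmAlgEquiv (Fin N) ℚ (Fintype.card_fin N)).surjective x
  have : (esymmAlgEquiv (Fin N) ℚ (Fintype.card_fin N)) p =
      aeval (fun i : Fin N => esub N (i+1)) p := by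
    ext1
    change (esymmAlgHom (Fin N) ℚ N p).val = _
    rfl
  rw [this]
  induction p using MvPolynomial.induction_on with
  | C a => simp
  | add p q hp hq =>
    rw [map_add]
    exact add_mem (hp trivial (by ext1; rfl)) (hq trivial (by ext1; rfl))
  | mul_X p i hp =>
    rw [map_mul, aeval_X]
    exact mul_mem (hp trivial (by ext1; rfl)) (esub_mem N _ (by omega))

theorem inj_of_surj {A : Type*} [CommRing A] [IsNoetherianRing A] (f : A →+* A)
    (hf : Function.Surjective f) : Function.Injective f := by
  let K : ℕ →o Ideal A := ⟨fun n => RingHom.ker (f ^ n), monotone_nat_of_le_succ fun n x hx => by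
    rw [RingHom.mem_ker] at hx ⊢
    rw [pow_succ', RingHom.mul_def, RingHom.comp_apply, hx, map_zero]⟩
  obtain ⟨n, hn⟩ := monotone_stabilizes_iff_noetherian.mpr (inferInstance : IsNoetherian A A) K
  rw [injective_iff_map_eq_zero]
  intro x hx
  have hs : Function.Surjective (f ^ n) := by
    rw [RingHom.coe_pow]; exact hf.iterate n
  obtain ⟨y, rfl⟩ := hs x
  have h1 : y ∈ K (n+1) := by
    change y ∈ RingHom.ker (f ^ (n+1))
    rw [RingHom.mem_ker, pow_succ', RingHom.mul_def, RingHom.comp_apply, hx]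
  rw [← hn (n+1) (by omega)] at h1
  exact h1

theorem hsub_inj : Function.Injective (hsub N) := by
  let e := esymmAlgEquiv (Fin N) ℚ (Fintype.card_fin N)
  let f : MvPolynomial (Fin N) ℚ →ₐ[ℚ] MvPolynomial (Fin N) ℚ := (e.symm : _ →ₐ[ℚ] _).comp (hsub N)
  have hf : Function.Surjective f := e.symm.surjective.comp (hsub_surj N)
  have hi : Function.Injective f.toRingHom :=
    inj_of_surj f.toRingHom hf
  intro a b hab
  apply hi
  change e.symm (hsub N a) = e.symm (hsub N b)
  rw [hab]

theorem phi_inj (f : SymFn) (hf : ∀ i ∈ f.vars, i < N) (h : phi N f = 0) : f = 0 := by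
  obtain ⟨g, rfl⟩ := exists_rename_eq_of_vars_subset_range f (Fin.val : Fin N → ℕ) Fin.val_injective
    (fun i hi => ⟨⟨i, hf i hi⟩, rfl⟩)
  have : g = 0 := by
    apply hsub_inj N
    ext1
    rw [map_zero]
    have h2 : ((symmetricSubalgebra (Fin N) ℚ).val.comp (hsub N)) g = phi N (rename Fin.val g) := by
      rw [phi, aeval_rename, hsub]
      congr 1
      ext1 i
      simp
    exact h2.trans h
  rw [this, map_zero]

end HK3

noncomputable section HK4

variable (N : ℕ)

def alt (a : Fin N → ℕ) : RR N := Matrix.det (Matrix.of fun i j : Fin N => (X i : RR N) ^ a j)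

def Ecoef (l : Fin N) (r : ℕ) : RR N := PowerSeries.coeff r (eser N (univ.erase l))

theorem Ecoef_zero (l : Fin N) (r : ℕ) (hr : N ≤ r) : Ecoef N l r = 0 := by
  rw [Ecoef, coeff_eser, Finset.powersetCard_eq_empty.mpr]
  · simp
  · rw [Finset.card_erase_of_mem (Finset.mem_univ _), Finset.card_univ, Fintype.card_fin]
    have := l.2
    omega

theorem hser_erase (l : Fin N) : hser N * eser N (univ.erase l) = geo (X l : RR N) := by
  have h := GG_mul (univ.erase l) (fun i : Fin N => (X i : RR N))
  have h2 : hser N = geo (X l : RR N) * GG (univ.erase l) (fun i : Fin N => (X i : RR N)) := by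
    rw [hser, GG, GG, Finset.mul_prod_erase _ (fun i : Fin N => geo (X i : RR N)) (mem_univ l)]
  rw [h2, mul_assoc]
  change _ * (_ * ∏ s ∈ univ.erase l, _) = _
  rw [h, mul_one]

theorem pow_eq (l : Fin N) (a : ℕ) : (X l : RR N) ^ a =
    ∑ j : Fin N, hcz N ((a : ℤ) - ((N - 1 - j : ℕ) : ℤ)) * Ecoef N l (N - 1 - j) := by
  have h := congrArg (PowerSeries.coeff a) (hser_erase N l)
  rw [mul_comm, PowerSeries.coeff_mul, Finset.Nat.sum_antidiagonal_eq_sum_range_succ_mk] at h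
  have h1 : PowerSeries.coeff a (geo (X l : RR N)) = X l ^ a := by simp [geo]
  rw [← h1, ← h]
  let F : ℕ → RR N := fun r => hcz N ((a : ℤ) - (r : ℤ)) * Ecoef N l r
  have h2 : ∑ k ∈ range a.succ, (PowerSeries.coeff k) (eser N (univ.erase l)) *
      (PowerSeries.coeff (a - k)) (hser N) = ∑ r ∈ range (a+1), F r := by
    refine Finset.sum_congr rfl fun r hr => ?_
    rw [Finset.mem_range] at hr
    rw [mul_comm]
    change hc N (a - r) * Ecoef N l r = hcz N _ * _
    congr 1
    rw [hcz, if_neg (by omega)]; congr 1; omega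
  have h3 : ∑ r ∈ range (a+1), F r = ∑ r ∈ range (max (a+1) N), F r := by
    refine Finset.sum_subset (Finset.range_subset_range.mpr (le_max_left _ _)) fun r _ hr => ?_
    rw [Finset.mem_range] at hr
    simp only [F]
    rw [hcz, if_pos (by omega), zero_mul]
  have h4 : ∑ r ∈ range N, F r = ∑ r ∈ range (max (a+1) N), F r := by
    refine Finset.sum_subset (Finset.range_subset_range.mpr (le_max_right _ _)) fun r _ hr => ?_
    rw [Finset.mem_range] at hr
    simp only [F]
    rw [Ecoef_zero N l r (by omega), mul_zero]
  rw [h2, h3, ← h4, ← Finset.sum_range_reflect, ← Fin.sum_univ_eq_sum_range (fun j => F (N - 1 - j))]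

def Hmat (a : Fin N → ℕ) : Matrix (Fin N) (Fin N) (RR N) :=
  Matrix.of fun i j => hcz N ((a i : ℤ) - ((N - 1 - j : ℕ) : ℤ))

def Emat : Matrix (Fin N) (Fin N) (RR N) := Matrix.of fun j l => Ecoef N l (N - 1 - j)

theorem alt_eq (a : Fin N → ℕ) : alt N a = (Hmat N a).det * (Emat N).det := by
  rw [← Matrix.det_mul, alt, ← Matrix.det_transpose]
  congr 1
  ext1 i l
  rw [Matrix.mul_apply]
  exact pow_eq N l (a i)

theorem det_Hmat_delta : (Hmat N (fun i => N - 1 - i)).det = 1 := by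
  rw [Matrix.det_of_isUpperTriangular]
  · refine Finset.prod_eq_one fun i _ => ?_
    simp [Hmat, hcz, hc_zero]
  · intro i j hij
    simp only [id] at hij
    simp only [Hmat, Matrix.of_apply, hcz]
    rw [if_pos]
    have := i.2; have := j.2
    have : j.1 < i.1 := hij
    omega

theorem det_pad (L : ℕ → ℕ) (l d : ℕ) (hL : ∀ i, l ≤ i → L i = 0) :
    Matrix.det (Matrix.of fun i j : Fin (l + d) => hcz N ((L i : ℤ) + (j : ℤ) - (i : ℤ))) =
    Matrix.det (Matrix.of fun i j : Fin l => hcz N ((L i : ℤ) + (j : ℤ) - (i : ℤ))) := by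
  induction d with
  | zero => rfl
  | succ d ih =>
    rw [← ih]
    change Matrix.det (Matrix.of fun i j : Fin ((l + d) + 1) => _) = _
    rw [Matrix.det_succ_row _ (Fin.last (l+d)), Fin.sum_univ_castSucc, Finset.sum_eq_zero, zero_add]
    · simp only [Matrix.of_apply, Fin.val_last]
      rw [hL _ (by omega)]
      have : hcz N (((0:ℕ) : ℤ) + ((l + d : ℕ) : ℤ) - ((l + d : ℕ) : ℤ)) = 1 := by
        simp [hcz, hc_zero]
      rw [this, ← two_mul, pow_mul]
      simp only [Fin.succAbove_last]
      simp
      rfl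
    · intro j _
      simp only [Matrix.of_apply, Fin.val_last]
      rw [hL _ (by omega), hcz, if_pos]
      · simp
      · have := j.2
        simp; omega

theorem jt (μ : Multiset ℕ) (hμ : Multiset.card μ ≤ N) :
    phi N (schur μ) * alt N (fun j => N - 1 - j) =
      alt N (fun j => (sortedParts μ).getD j 0 + (N - 1 - j)) := by
  rw [alt_eq, alt_eq, det_Hmat_delta, one_mul]
  congr 1
  obtain ⟨d, hd⟩ := Nat.exists_eq_add_of_le hμ
  have hp := det_pad N (fun i => (sortedParts μ).getD i 0) (Multiset.card μ) d (by
    intro i hi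
    apply List.getD_eq_default
    simpa [sortedParts] using hi)
  rw [schur, AlgHom.map_det]
  have e1 : (phi N).mapMatrix (Matrix.of fun i j : Fin (Multiset.card μ) =>
    hh (((sortedParts μ).getD i 0 : ℤ) + (j : ℤ) - (i : ℤ))) = Matrix.of fun i j : Fin (Multiset.card μ) =>
    hcz N (((sortedParts μ).getD i 0 : ℤ) + (j : ℤ) - (i : ℤ)) := by
    ext1 i j
    simp [phi_hh]
  rw [e1]
  refine hp.symm.trans ?_
  rw [← Matrix.det_submatrix_equiv_self (finCongr hd.symm)]
  congr 1
  ext1 i j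
  simp only [Hmat, Matrix.submatrix_apply, Matrix.of_apply]
  congr 1
  have := i.2; have := j.2
  simp only [finCongr_apply, Fin.val_cast]
  push_cast
  omega

end HK4

noncomputable section HK5

theorem alt_perm (N : ℕ) (a : Fin N → ℕ) (τ : Equiv.Perm (Fin N)) :
    rename τ (alt N a) = ((Equiv.Perm.sign τ : ℤ) : RR N) * alt N a := by
  rw [alt, AlgHom.map_det, ← Matrix.det_permute]
  congr 1
  ext1 i j
  simp

theorem alt_homog (N : ℕ) (a : Fin N → ℕ) : (alt N a).IsHomogeneous (∑ j, a j) := by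
  rw [alt, Matrix.det_apply]
  refine IsHomogeneous.sum _ _ _ fun σ _ => ?_
  have : (∏ j, (Matrix.of fun i j : Fin N => (X i : RR N) ^ a j) (σ j) j).IsHomogeneous (∑ j, a j) := by
    refine IsHomogeneous.prod _ _ _ fun j _ => ?_
    simpa using (isHomogeneous_X ℚ (σ j)).pow (a j)
  rcases Int.units_eq_one_or (Equiv.Perm.sign σ) with h | h
  · rw [h]; simpa using this
  · rw [h]; simpa using this.neg

theorem anti_zero (N : ℕ) (f : RR N) (d : ℕ)
    (h1 : ∀ τ : Equiv.Perm (Fin N), rename τ f = ((Equiv.Perm.sign τ : ℤ) : RR N) * f)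
    (h2 : ∀ i, degreeOf i f ≤ N - 1) (h3 : f.IsHomogeneous d)
    (hd : d ≠ ∑ i ∈ range N, i) : f = 0 := by
  ext s
  rw [coeff_zero]
  by_contra hs
  have hinj : Function.Injective s := by
    intro i j hij
    by_contra hne
    have h := h1 (Equiv.swap i j)
    rw [Equiv.Perm.sign_swap hne] at h
    have h' := congrArg (coeff s) h
    have hm : s.mapDomain (Equiv.swap i j) = s := by
      ext x
      rw [Finsupp.mapDomain_equiv_apply, Equiv.symm_swap]
      by_cases hx : x = i
      · rw [hx, Equiv.swap_apply_left, hij]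
      by_cases hx2 : x = j
      · rw [hx2, Equiv.swap_apply_right, hij]
      rw [Equiv.swap_apply_of_ne_of_ne hx hx2]
    nth_rewrite 1 [← hm] at h'
    rw [coeff_rename_mapDomain _ (Equiv.injective _)] at h'
    simp at h'
    exact hs (by linarith)
  have hlt : ∀ i, s i < N := by
    intro i
    have := (degreeOf_le_iff.mp (h2 i)) s (mem_support_iff.mpr hs)
    have := i.2
    omega
  have hdeg : s.degree = d := by
    have := h3 hs
    rw [Finsupp.degree_eq_weight_one]; exact this
  apply hd
  rw [← hdeg, Finsupp.degree_eq_sum, ← Fin.sum_univ_eq_sum_range (fun i => i)]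
  have hb : Function.Bijective (fun i : Fin N => (⟨s i, hlt i⟩ : Fin N)) :=
    Finite.injective_iff_bijective.mp fun i j hij => hinj (by simpa using hij)
  exact Fintype.sum_bijective _ hb _ _ fun i => rfl

variable (m : ℕ)

def pr : Fin m × Fin 2 ≃ Fin (m * 2) := finProdFinEquiv

theorem pr_val (t : Fin m) (b : Fin 2) : (pr m (t, b)).val = b + 2 * t := rfl

def expo (c : Fin m → ℕ) : Fin (m * 2) → ℕ := fun j => c ((pr m).symm j).1 + (1 - ((pr m).symm j).2)

abbrev sg (σ : Equiv.Perm (Fin (m * 2))) (t : Fin m) : Finset (Fin (m * 2)) :=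
  {σ (pr m (t, 0)), σ (pr m (t, 1))}

theorem sg_ne (σ : Equiv.Perm (Fin (m * 2))) (t : Fin m) : σ (pr m (t, 0)) ≠ σ (pr m (t, 1)) := by
  simp

def Fterm (σ : Equiv.Perm (Fin (m * 2))) : PowerSeries (RR (m*2)) :=
  ∏ t : Fin m, (PowerSeries.C (X (σ (pr m (t, 0)))) * geo (ys (m*2) (sg m σ t)))

def FF : PowerSeries (RR (m*2)) :=
  ∑ σ : Equiv.Perm (Fin (m * 2)), PowerSeries.C ((Equiv.Perm.sign σ : ℤ) : RR (m*2)) * Fterm m σ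

theorem coeff_FF (K : ℕ) : PowerSeries.coeff K (FF m) =
    ∑ c ∈ finsuppAntidiag (univ : Finset (Fin m)) K, alt (m*2) (expo m c) := by
  simp only [alt, Matrix.det_apply]
  rw [Finset.sum_comm, FF, map_sum]
  refine Finset.sum_congr rfl fun σ _ => ?_
  rw [PowerSeries.coeff_C_mul, Fterm, PowerSeries.coeff_prod, Finset.mul_sum]
  refine Finset.sum_congr rfl fun c _ => ?_
  rw [Units.smul_def, zsmul_eq_mul]
  congr 1
  rw [← (pr m).prod_comp, Fintype.prod_prod_type]
  refine Finset.prod_congr rfl fun t _ => ?_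
  rw [Fin.prod_univ_two, PowerSeries.coeff_C_mul]
  simp only [geo, PowerSeries.coeff_mk, ys, Matrix.of_apply, expo, Equiv.symm_apply_apply]
  rw [Finset.prod_pair (sg_ne m σ t)]
  simp only [Fin.val_zero, Fin.val_one]
  ring

theorem FF_anti (K : ℕ) (τ : Equiv.Perm (Fin (m*2))) : rename τ (PowerSeries.coeff K (FF m)) =
    ((Equiv.Perm.sign τ : ℤ) : RR (m*2)) * PowerSeries.coeff K (FF m) := by
  rw [coeff_FF, map_sum, Finset.mul_sum]
  exact Finset.sum_congr rfl fun c _ => alt_perm _ _ _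

theorem sum_expo (c : Fin m → ℕ) : ∑ j, expo m c j = m + 2 * ∑ t, c t := by
  rw [← (pr m).sum_comp, Fintype.sum_prod_type]
  simp only [expo, Equiv.symm_apply_apply, Fin.sum_univ_two, Fin.val_zero, Fin.val_one]
  rw [Finset.mul_sum]
  have : ∀ t, c t + (1 - 0) + (c t + (1 - 1)) = 1 + 2 * c t := by intro t; omega
  simp only [this, Finset.sum_add_distrib]
  simp

theorem FF_homog (K : ℕ) : (PowerSeries.coeff K (FF m)).IsHomogeneous (m + 2 * K) := by
  rw [coeff_FF]
  refine IsHomogeneous.sum _ _ _ fun c hc => ?_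
  rw [mem_finsuppAntidiag] at hc
  rw [← hc.1, ← sum_expo]
  exact alt_homog _ _

def PP (N : ℕ) : PowerSeries (RR N) := ∏ s ∈ S2 N, (1 - PowerSeries.C (ys N s) * PowerSeries.X)

theorem PP_symm (N : ℕ) (e : Equiv.Perm (Fin N)) :
    PowerSeries.map (rename e : RR N →ₐ[ℚ] RR N).toRingHom (PP N) = PP N := by
  unfold PP
  rw [map_prod]
  refine Finset.prod_equiv e.finsetCongr ?_ ?_
  · intro s; simp [mem_powersetCard]
  · intro s _
    simp [ys]

theorem PP_homog (N K : ℕ) : (PowerSeries.coeff K (PP N)).IsHomogeneous (2 * K) := by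
  unfold PP
  have key : ∀ T : Finset (Finset (Fin N)), T ⊆ S2 N → ∀ K, (PowerSeries.coeff K
      (∏ s ∈ T, (1 - PowerSeries.C (ys N s) * PowerSeries.X))).IsHomogeneous (2 * K) := by
    intro T
    induction T using Finset.induction_on with
    | empty =>
      intro _ K
      rw [Finset.prod_empty, PowerSeries.coeff_one]
      split_ifs with h
      · subst h; exact isHomogeneous_one _ _
      · exact isHomogeneous_zero _ _ _
    | insert s T hs ih =>
      intro hT K
      have ih' := ih ((Finset.subset_insert _ _).trans hT)
      have hs2 : #s = 2 := (mem_powersetCard.mp (hT (mem_insert_self _ _))).2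
      have hy : (ys N s).IsHomogeneous 2 := by
        rw [← hs2, Finset.card_eq_sum_ones]
        exact IsHomogeneous.prod _ _ _ fun i _ => isHomogeneous_X _ _
      rw [Finset.prod_insert hs, sub_mul, one_mul, map_sub, mul_assoc, PowerSeries.coeff_C_mul]
      refine IsHomogeneous.sub (ih' K) ?_
      cases K with
      | zero => simpa using isHomogeneous_zero _ _ _
      | succ K =>
        rw [PowerSeries.coeff_succ_X_mul]
        have : 2 * (K + 1) = 2 + 2 * K := by ring
        rw [this]
        exact hy.mul (ih' K)
  exact key _ (Finset.Subset.refl _) K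

def QQ : PowerSeries (RR (m*2)) := FF m * PP (m*2)

theorem QQ_anti (K : ℕ) (τ : Equiv.Perm (Fin (m*2))) : rename τ (PowerSeries.coeff K (QQ m)) =
    ((Equiv.Perm.sign τ : ℤ) : RR (m*2)) * PowerSeries.coeff K (QQ m) := by
  rw [QQ, PowerSeries.coeff_mul, map_sum, Finset.mul_sum]
  refine Finset.sum_congr rfl fun p _ => ?_
  have h := congrArg (PowerSeries.coeff p.2) (PP_symm (m*2) τ)
  rw [PowerSeries.coeff_map] at h
  have h' : rename τ (PowerSeries.coeff p.2 (PP (m*2))) = PowerSeries.coeff p.2 (PP (m*2)) := h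
  rw [map_mul, FF_anti, h', mul_assoc]

theorem QQ_homog (K : ℕ) : (PowerSeries.coeff K (QQ m)).IsHomogeneous (m + 2 * K) := by
  rw [QQ, PowerSeries.coeff_mul]
  refine IsHomogeneous.sum _ _ _ fun p hp => ?_
  rw [HasAntidiagonal.mem_antidiagonal] at hp
  have : m + 2 * K = (m + 2 * p.1) + 2 * p.2 := by rw [← hp]; ring
  rw [this]
  exact (FF_homog m _).mul (PP_homog _ _)

/-- degree bound on all coefficients. -/
def DB {N : ℕ} (i : Fin N) (d : ℕ) (f : PowerSeries (RR N)) : Prop :=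
  ∀ k, degreeOf i (PowerSeries.coeff k f) ≤ d

theorem DB_mul {N : ℕ} {i : Fin N} {d e : ℕ} {f g : PowerSeries (RR N)} (hf : DB i d f)
    (hg : DB i e g) : DB i (d + e) (f * g) := by
  intro k
  rw [PowerSeries.coeff_mul]
  refine (degreeOf_sum_le _ _ _).trans (Finset.sup_le fun p _ => ?_)
  exact (degreeOf_mul_le _ _ _).trans (add_le_add (hf _) (hg _))

theorem DB_C {N : ℕ} {i : Fin N} {d : ℕ} {f : RR N} (hf : degreeOf i f ≤ d) :
    DB i d (PowerSeries.C f) := by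
  intro k
  rw [PowerSeries.coeff_C]
  split_ifs
  · exact hf
  · simp

theorem degreeOf_ys (N : ℕ) (i : Fin N) (s : Finset (Fin N)) :
    degreeOf i (ys N s) ≤ if i ∈ s then 1 else 0 := by
  rw [ys]
  refine (degreeOf_prod_le _ _ _).trans ?_
  simp only [degreeOf_X]
  simp

theorem DB_factor {N : ℕ} (i : Fin N) (s : Finset (Fin N)) :
    DB i (if i ∈ s then 1 else 0) (1 - PowerSeries.C (ys N s) * PowerSeries.X) := by
  intro k
  rw [map_sub, PowerSeries.coeff_C_mul, PowerSeries.coeff_one, PowerSeries.coeff_X]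
  refine (degreeOf_sub_le _ _ _).trans (max_le ?_ ?_)
  · split_ifs <;> simp
  · refine (degreeOf_mul_le _ _ _).trans ?_
    have h := degreeOf_ys N i s
    have h2 : degreeOf i (if k = 1 then (1 : RR N) else 0) = 0 := by split_ifs <;> simp
    rw [h2]; exact h

theorem DB_prod {N : ℕ} (i : Fin N) (T : Finset (Finset (Fin N))) :
    DB i (#{s ∈ T | i ∈ s}) (∏ s ∈ T, (1 - PowerSeries.C (ys N s) * PowerSeries.X)) := by
  induction T using Finset.induction_on with
  | empty => intro k; rw [Finset.prod_empty, PowerSeries.coeff_one]; split_ifs <;> simp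
  | insert s T hs ih =>
    rw [Finset.prod_insert hs, Finset.card_filter, Finset.sum_insert hs, ← Finset.card_filter]
    exact DB_mul (DB_factor i s) ih

theorem sg_inj (σ : Equiv.Perm (Fin (m * 2))) : Function.Injective (sg m σ) := by
  intro t t' h
  have : σ (pr m (t, 0)) ∈ sg m σ t' := by rw [← h]; simp
  simp at this
  exact this

theorem Fterm_PP (σ : Equiv.Perm (Fin (m * 2))) : Fterm m σ * PP (m*2) =
    PowerSeries.C (∏ t, (X (σ (pr m (t, 0))) : RR (m*2))) *
      ∏ s ∈ S2 (m*2) \ univ.image (sg m σ), (1 - PowerSeries.C (ys (m*2) s) * PowerSeries.X) := by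
  have hsub : univ.image (sg m σ) ⊆ S2 (m*2) := by
    intro s hs
    rw [mem_image] at hs
    obtain ⟨t, _, rfl⟩ := hs
    rw [mem_powersetCard]
    exact ⟨subset_univ _, card_pair (sg_ne m σ t)⟩
  rw [PP, ← Finset.prod_sdiff hsub, Fterm, Finset.prod_mul_distrib, ← map_prod,
    Finset.prod_image (fun a _ b _ h => sg_inj m σ h)]
  have : (∏ t, geo (ys (m*2) (sg m σ t))) *
      ∏ t, (1 - PowerSeries.C (ys (m*2) (sg m σ t)) * PowerSeries.X) = 1 := by
    rw [← Finset.prod_mul_distrib]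
    exact Finset.prod_eq_one fun t _ => geo_mul _
  linear_combination (PowerSeries.C (∏ t, (X (σ (pr m (t, 0))) : RR (m*2))) *
      ∏ s ∈ S2 (m*2) \ univ.image (sg m σ), (1 - PowerSeries.C (ys (m*2) s) * PowerSeries.X)) * this

theorem count_le (σ : Equiv.Perm (Fin (m * 2))) (i : Fin (m * 2)) :
    #{s ∈ S2 (m*2) \ univ.image (sg m σ) | i ∈ s} ≤ m * 2 - 2 := by
  obtain ⟨i', hne, t, ht⟩ : ∃ i', i' ≠ i ∧ ∃ t, sg m σ t = {i, i'} := by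
    obtain ⟨j, rfl⟩ := σ.surjective i
    obtain ⟨⟨t, b⟩, rfl⟩ := (pr m).surjective j
    fin_cases b
    · exact ⟨σ (pr m (t, 1)), by simp, t, rfl⟩
    · exact ⟨σ (pr m (t, 0)), by simp, t, Finset.pair_comm _ _⟩
  have hsub : {s ∈ S2 (m*2) \ univ.image (sg m σ) | i ∈ s} ⊆
      ((univ.erase i).erase i').image (fun j => {i, j}) := by
    intro s hs
    rw [mem_filter, mem_sdiff, mem_powersetCard] at hs
    obtain ⟨⟨⟨_, h2⟩, h3⟩, h4⟩ := hs
    obtain ⟨a, b, hab, rfl⟩ := card_eq_two.mp h2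
    have key : ∃ j, j ≠ i ∧ ({a, b} : Finset (Fin (m*2))) = {i, j} := by
      simp at h4
      rcases h4 with rfl | rfl
      · exact ⟨b, hab.symm, rfl⟩
      · exact ⟨a, hab, Finset.pair_comm _ _⟩
    obtain ⟨j, hj, hj2⟩ := key
    rw [mem_image]
    refine ⟨j, ?_, hj2.symm⟩
    rw [mem_erase, mem_erase]
    refine ⟨?_, hj, mem_univ _⟩
    rintro rfl
    exact h3 (mem_image.mpr ⟨t, mem_univ _, by rw [ht, hj2]⟩)
  refine (card_le_card hsub).trans (card_image_le.trans ?_)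
  rw [card_erase_of_mem (by simp [hne]), card_erase_of_mem (mem_univ _), card_univ, Fintype.card_fin]
  omega

theorem QQ_deg (i : Fin (m*2)) (K : ℕ) : degreeOf i (PowerSeries.coeff K (QQ m)) ≤ m * 2 - 1 := by
  rw [QQ, FF, Finset.sum_mul, map_sum]
  refine (degreeOf_sum_le _ _ _).trans (Finset.sup_le fun σ _ => ?_)
  rw [mul_assoc, PowerSeries.coeff_C_mul, Fterm_PP]
  refine (degreeOf_mul_le _ _ _).trans ?_
  have h0 : degreeOf i (((Equiv.Perm.sign σ : ℤ) : RR (m*2))) = 0 := by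
    have := degreeOf_C (((Equiv.Perm.sign σ : ℤ) : ℚ)) i
    simpa using this
  have h1 : degreeOf i (∏ t, (X (σ (pr m (t, 0))) : RR (m*2))) ≤ 1 := by
    refine (degreeOf_prod_le _ _ _).trans ?_
    simp only [degreeOf_X]
    rw [← Finset.card_filter, Finset.card_le_one]
    intro a ha b hb
    simp at ha hb
    have := ha.symm.trans hb
    simpa using this
  have h2 := DB_mul (DB_C h1) (DB_prod i (S2 (m*2) \ univ.image (sg m σ))) K
  have h3 := count_le m σ i
  have := i.2
  omega

theorem QQ_zero (K : ℕ) (hK : K ≠ m * (m - 1)) : PowerSeries.coeff K (QQ m) = 0 := by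
  refine anti_zero _ _ _ (QQ_anti m K) (fun i => QQ_deg m i K) (QQ_homog m K) ?_
  intro h
  rw [Finset.sum_range_id] at h
  apply hK
  cases m with
  | zero => simp at h; simp [h]
  | succ n =>
    have e : (n + 1) * 2 * ((n + 1) * 2 - 1) / 2 = (n + 1) * (2 * n + 1) := by
      have : (n + 1) * 2 * ((n + 1) * 2 - 1) = ((n + 1) * (2 * n + 1)) * 2 := by
        have : (n + 1) * 2 - 1 = 2 * n + 1 := by omega
        rw [this]; ring
      rw [this, Nat.mul_div_cancel _ (by norm_num)]
    rw [e] at h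
    simp only [Nat.add_sub_cancel]
    nlinarith

theorem FF_main (k : ℕ) : PowerSeries.coeff (k + m * (m - 1)) (FF m) =
    PowerSeries.coeff (m * (m - 1)) (FF m) * gs (m*2) k := by
  have hG : GG (S2 (m*2)) (ys (m*2)) * PP (m*2) = 1 := GG_mul _ _
  have hQ : QQ m = PowerSeries.C (PowerSeries.coeff (m * (m-1)) (QQ m)) *
      PowerSeries.X ^ (m * (m-1)) := by
    ext1 K
    rw [PowerSeries.coeff_C_mul, PowerSeries.coeff_X_pow]
    split_ifs with h
    · rw [h, mul_one]
    · rw [QQ_zero m K h, mul_zero]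
  have hF : FF m = PowerSeries.C (PowerSeries.coeff (m * (m-1)) (QQ m)) *
      (GG (S2 (m*2)) (ys (m*2)) * PowerSeries.X ^ (m * (m-1))) := by
    have : FF m = QQ m * GG (S2 (m*2)) (ys (m*2)) := by
      rw [QQ, mul_assoc, mul_comm (PP _), hG, mul_one]
    rw [this]
    nth_rewrite 1 [hQ]
    ring
  have hk : ∀ k, PowerSeries.coeff (k + m * (m - 1)) (FF m) =
      PowerSeries.coeff (m * (m-1)) (QQ m) * gs (m*2) k := by
    intro k
    rw [hF, PowerSeries.coeff_C_mul, PowerSeries.coeff_mul_X_pow]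
    rfl
  have h0 := hk 0
  rw [zero_add, gs, GG_zero, mul_one] at h0
  rw [hk, h0]

end HK5

noncomputable section HK6

def ct (P : Multiset ℕ) (t : ℕ) : ℕ := Multiset.card (P.filter fun x => t < x)

theorem ct_anti (P : Multiset ℕ) : Antitone (ct P) := by
  intro s t hst
  exact Multiset.card_le_card (Multiset.monotone_filter_right P fun x hx => lt_of_le_of_lt hst hx)

theorem ct_zero (P : Multiset ℕ) (t : ℕ) (h : ∀ x ∈ P, x ≤ t) : ct P t = 0 := by
  rw [ct, Multiset.card_eq_zero, Multiset.filter_eq_nil]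
  intro x hx
  have := h x hx
  omega

theorem sum_ct (P : Multiset ℕ) (m : ℕ) (h : ∀ x ∈ P, x ≤ m) : ∑ t ∈ range m, ct P t = P.sum := by
  induction P using Multiset.induction_on with
  | empty => simp [ct]
  | cons a P ih =>
    have h1 := ih fun x hx => h x (Multiset.mem_cons_of_mem hx)
    have ha := h a (Multiset.mem_cons_self a P)
    have h2 : ∀ t, ct (a ::ₘ P) t = (if t < a then 1 else 0) + ct P t := by
      intro t
      by_cases hta : t < a <;> simp [ct, hta, add_comm]
    simp only [h2]
    rw [Finset.sum_add_distrib, h1, Multiset.sum_cons, ← Finset.card_filter]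
    congr 1
    have : (range m).filter (fun t => t < a) = range a := by
      ext x; simp; omega
    rw [this, card_range]

theorem ct_succ (P : Multiset ℕ) (t : ℕ) : ct P t = ct P (t+1) + P.count (t+1) := by
  induction P using Multiset.induction_on with
  | empty => simp [ct]
  | cons a P ih =>
    have h2 : ∀ t, ct (a ::ₘ P) t = (if t < a then 1 else 0) + ct P t := by
      intro t
      by_cases hta : t < a <;> simp [ct, hta, add_comm]
    rw [h2, h2, ih, Multiset.count_cons]
    split_ifs <;> omega

theorem part_ext {k : ℕ} (α β : Nat.Partition k) (h : ∀ t, ct α.parts t = ct β.parts t) : α = β := by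
  ext x
  cases x with
  | zero =>
    rw [Multiset.count_eq_zero_of_notMem, Multiset.count_eq_zero_of_notMem]
    · intro h0; exact absurd (β.parts_pos h0) (by omega)
    · intro h0; exact absurd (α.parts_pos h0) (by omega)
  | succ t =>
    have h1 := ct_succ α.parts t
    have h2 := ct_succ β.parts t
    have := h t
    have := h (t+1)
    omega

theorem part_le {k : ℕ} (α : Nat.Partition k) : ∀ x ∈ α.parts, x ≤ k := by
  intro x hx
  have h := Multiset.single_le_sum (fun _ _ => Nat.zero_le _) x hx
  rw [α.parts_sum] at h
  exact h

theorem exists_part (m k : ℕ) (μ : Fin m → ℕ) (hμ : Antitone μ) (hs : ∑ t, μ t = k) :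
    ∃ α : Nat.Partition k, ∀ t : Fin m, ct α.parts t = μ t := by
  have hle : ∀ t, μ t ≤ k := fun t => hs ▸ Finset.single_le_sum (fun _ _ => Nat.zero_le _) (mem_univ t)
  let f : ℕ → ℕ := fun j => #{t : Fin m | j < μ t}
  have hf : ∀ (j : ℕ) (t : Fin m), (t : ℕ) < f j ↔ j < μ t := by
    intro j t
    constructor
    · intro h
      by_contra hc
      have : ({t : Fin m | j < μ t} : Finset (Fin m)) ⊆ Finset.Iio t := by
        intro s hs
        simp only [mem_filter, mem_univ, true_and] at hs
        rw [mem_Iio]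
        by_contra hst
        have := hμ (not_lt.mp hst)
        omega
      have := card_le_card this
      rw [Fin.card_Iio] at this
      simp only [f] at h
      omega
    · intro h
      have : Finset.Iic t ⊆ ({t : Fin m | j < μ t} : Finset (Fin m)) := by
        intro s hs
        simp only [mem_filter, mem_univ, true_and]
        rw [mem_Iic] at hs
        have := hμ hs
        omega
      have := card_le_card this
      rw [Fin.card_Iic] at this
      simp only [f]
      omega
  have hsum : ((Multiset.range k).map f).sum = k := by
    change ∑ j ∈ range k, f j = k
    simp only [f, Finset.card_filter]
    rw [Finset.sum_comm]
    nth_rewrite 2 [← hs]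
    refine Finset.sum_congr rfl fun t _ => ?_
    rw [← Finset.card_filter]
    have : (range k).filter (fun j => j < μ t) = range (μ t) := by
      ext x; have := hle t; simp; omega
    rw [this, card_range]
  refine ⟨Nat.Partition.ofSums k _ hsum, fun t => ?_⟩
  rw [ct, Nat.Partition.ofSums_parts, Multiset.filter_filter, Multiset.filter_map, Multiset.card_map]
  change #((range k).filter _) = _
  have : (range k).filter ((fun a => (t:ℕ) < a ∧ a ≠ 0) ∘ f) = range (μ t) := by
    ext x
    have := hle t
    have := hf x t
    simp
    omega
  rw [this, card_range]

theorem sorted_conj (P : Multiset ℕ) : sortedParts (conj (double P)) =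
    (List.range (double P).sup).map fun i => ct P (i / 2) := by
  have h1 : conj (double P) = (((List.range (double P).sup).map fun i => ct P (i / 2) : List ℕ) : Multiset ℕ) := by
    unfold conj
    congr 1
    refine List.map_congr_left fun i _ => ?_
    rw [double, Multiset.filter_map, Multiset.card_map, ct]
    congr 1
    refine Multiset.filter_congr fun x _ => ?_
    simp only [Function.comp]
    omega
  rw [h1, sortedParts]
  refine List.Perm.eq_of_sortedGE ?_ ?_ ?_
  · rw [List.sortedGE_reverse]
    exact (Multiset.pairwise_sort _ _).sortedLE
  · refine List.Pairwise.sortedGE ?_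
    rw [List.pairwise_map]
    refine List.Pairwise.imp ?_ (List.pairwise_lt_range)
    intro a b hab
    exact ct_anti P (Nat.div_le_div_right hab.le)
  · refine (List.reverse_perm _).trans ?_
    rw [← Multiset.coe_eq_coe, Multiset.sort_eq]

theorem getD_conj (P : Multiset ℕ) (j : ℕ) : (sortedParts (conj (double P))).getD j 0 = ct P (j / 2) := by
  rw [sorted_conj]
  by_cases h : j < (double P).sup
  · rw [List.getD_eq_getElem _ _ (by simpa using h)]
    simp
  · rw [List.getD_eq_default _ _ (by simpa using h), ct_zero]
    intro x hx
    have : 2 * x ∈ double P := Multiset.mem_map_of_mem _ hx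
    have := Multiset.le_sup this
    omega

theorem card_conj (P : Multiset ℕ) (m : ℕ) (h : ∀ x ∈ P, x ≤ m) :
    Multiset.card (conj (double P)) ≤ m * 2 := by
  simp only [conj, Multiset.coe_card, List.length_map, List.length_range]
  rw [Multiset.sup_le]
  intro b hb
  obtain ⟨x, hx, rfl⟩ := Multiset.mem_map.mp hb
  have := h x hx
  omega

variable (m : ℕ)

def cc (P : Multiset ℕ) : Fin m → ℕ := fun t => ct P t + 2 * (m - 1 - t)

theorem cc_anti (P : Multiset ℕ) : StrictAnti (cc m P) := by
  intro s t hst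
  have h1 := ct_anti P (show (s:ℕ) ≤ t from le_of_lt hst)
  have h2 : (s:ℕ) < t := hst
  have := t.2
  simp only [cc]
  omega

theorem sum_two : ∑ t : Fin m, 2 * (m - 1 - t : ℕ) = m * (m - 1) := by
  rw [Fin.sum_univ_eq_sum_range (fun t => 2 * (m - 1 - t)) m, ← Finset.mul_sum,
    Finset.sum_range_reflect (fun t => t) m, mul_comm, Finset.sum_range_id_mul_two]

theorem sum_cc {k : ℕ} (hk : k ≤ m) (α : Nat.Partition k) :
    ∑ t, cc m α.parts t = k + m * (m - 1) := by
  simp only [cc]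
  rw [Finset.sum_add_distrib, sum_two, Fin.sum_univ_eq_sum_range (ct α.parts) m, sum_ct, α.parts_sum]
  intro x hx
  exact (part_le α x hx).trans hk

theorem phi_schur {k : ℕ} (hk : k ≤ m) (α : Nat.Partition k) :
    phi (m*2) (schur (conj (double α.parts))) * alt (m*2) (fun j => m * 2 - 1 - j) =
      alt (m*2) (expo m (cc m α.parts)) := by
  rw [jt _ _ (card_conj _ m fun x hx => (part_le α x hx).trans hk)]
  congr 1
  ext1 j
  obtain ⟨⟨t, b⟩, rfl⟩ := (pr m).surjective j
  rw [getD_conj, expo, Equiv.symm_apply_apply, pr_val, cc]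
  have h1 : ((b:ℕ) + 2 * t) / 2 = t := by have := b.2; omega
  rw [h1]
  have := t.2; have := b.2
  simp only
  omega

theorem alt_expo_perm (c : Fin m → ℕ) (σ : Equiv.Perm (Fin m)) :
    alt (m*2) (expo m (c ∘ σ)) = alt (m*2) (expo m c) := by
  let τ : Equiv.Perm (Fin m × Fin 2) := Equiv.prodCongrLeft fun _ => σ
  let π : Equiv.Perm (Fin (m*2)) := (pr m).permCongr τ
  have hs : Equiv.Perm.sign π = 1 := by
    rw [Equiv.Perm.sign_permCongr, Equiv.Perm.sign_prodCongrLeft]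
    simp
  have h : alt (m*2) (expo m (c ∘ σ)) =
      ((Matrix.of fun i j : Fin (m*2) => (X i : RR (m*2)) ^ expo m c j).submatrix id π).det := by
    rw [alt]
    congr 1
    ext1 i j
    simp [expo, π, τ, Equiv.permCongr_apply]
  rw [h, Matrix.det_permute', hs]
  simp [alt]

theorem expo_inj (c : Fin m → ℕ) (h : alt (m*2) (expo m c) ≠ 0) : Function.Injective (expo m c) := by
  intro i j hij
  by_contra hne
  apply h
  rw [alt]
  exact Matrix.det_zero_of_column_eq hne (fun l => by simp [hij])

theorem exists_sorted {k : ℕ} (c : Fin m → ℕ) (hc : ∑ t, c t = k + m * (m - 1))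
    (h : alt (m*2) (expo m c) ≠ 0) :
    ∃ (σ : Equiv.Perm (Fin m)) (α : Nat.Partition k), cc m α.parts ∘ σ = c := by
  have hinj := expo_inj m c h
  have hgap : ∀ s t, c s ≤ c t → s ≠ t → c s + 2 ≤ c t := by
    intro s t hle hne
    have h1 : c s ≠ c t := by
      intro he
      have : expo m c (pr m (s, 0)) = expo m c (pr m (t, 0)) := by simp [expo, he]
      have := hinj this
      simp [hne] at this
    have h2 : c s + 1 ≠ c t := by
      intro he
      have : expo m c (pr m (s, 0)) = expo m c (pr m (t, 1)) := by simp [expo, he]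
      have := hinj this
      simp [hne] at this
    omega
  let τ : Equiv.Perm (Fin m) := Fin.revPerm.trans (Tuple.sort c)
  let d : Fin m → ℕ := c ∘ τ
  have hd : Antitone d := by
    intro s t hst
    have := Tuple.monotone_sort c (Fin.rev_le_rev.mpr hst)
    simpa [d, τ] using this
  have hd2 : ∀ s t, s < t → d t + 2 ≤ d s := by
    intro s t hst
    refine hgap _ _ (hd hst.le) ?_
    intro he
    exact hst.ne' (τ.injective he)
  have hd3 : ∀ (n : ℕ) (s t : Fin m), (s : ℕ) + n = t → d t + 2 * n ≤ d s := by
    intro n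
    induction n with
    | zero =>
      intro s t hst
      have : s = t := Fin.ext hst
      rw [this]; omega
    | succ n ih =>
      intro s t hst
      have hlt : (s : ℕ) + n < m := by have := t.2; omega
      have h1 := ih s ⟨s + n, hlt⟩ rfl
      have h2 := hd2 ⟨s + n, hlt⟩ t (by rw [Fin.lt_def]; simp only; omega)
      omega
  have hlow : ∀ t : Fin m, 2 * (m - 1 - t) ≤ d t := by
    intro t
    have := t.2
    have := hd3 (m - 1 - t) t ⟨m - 1, by omega⟩ (by simp only; omega)
    omega
  let μ : Fin m → ℕ := fun t => d t - 2 * (m - 1 - t)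
  have hμ : Antitone μ := by
    intro s t hst
    have hst' : (s : ℕ) ≤ t := hst
    have h1 := hd3 (t - s) s t (by omega)
    have := hlow s
    have := hlow t
    have := t.2
    simp only [μ]
    omega
  have hsum : ∑ t, μ t = k := by
    have h1 : ∑ t, d t = k + m * (m - 1) := by
      rw [← hc]; exact Equiv.sum_comp τ c
    have h2 : ∑ t, d t = ∑ t, μ t + ∑ t : Fin m, 2 * (m - 1 - t : ℕ) := by
      rw [← Finset.sum_add_distrib]
      refine Finset.sum_congr rfl fun t _ => ?_
      have := hlow t
      simp only [μ]
      omega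
    rw [sum_two] at h2
    omega
  obtain ⟨α, hα⟩ := exists_part m k μ hμ hsum
  refine ⟨τ.symm, α, ?_⟩
  ext1 t
  have h1 := hα (τ.symm t)
  have h2 := hlow (τ.symm t)
  have h3 : d (τ.symm t) = c t := by simp [d]
  simp only [Function.comp, cc]
  rw [h1]
  simp only [μ]
  omega

theorem cc_perm_inj {k : ℕ} (hk : k ≤ m) (σ τ : Equiv.Perm (Fin m)) (α β : Nat.Partition k)
    (h : cc m α.parts ∘ σ = cc m β.parts ∘ τ) : σ = τ ∧ α = β := by
  have hm : StrictMono (τ.symm.trans σ) := by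
    intro i j hij
    have h1 := cc_anti m β.parts hij
    have h2 := congrFun h (τ.symm i)
    have h3 := congrFun h (τ.symm j)
    simp only [Function.comp, Equiv.apply_symm_apply] at h2 h3
    rw [← h2, ← h3] at h1
    exact (cc_anti m α.parts).lt_iff_gt.mp h1
  have he : (τ.symm.trans σ : Fin m → Fin m) = id := by
    rw [← hm.range_inj strictMono_id]
    simp
  have hst : σ = τ := by
    ext1 x
    have := congrFun he (τ x)
    simpa using this
  subst hst
  refine ⟨rfl, part_ext _ _ fun t => ?_⟩
  by_cases ht : t < m
  · have := congrFun h (σ.symm ⟨t, ht⟩)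
    simp [cc] at this
    exact this
  · rw [ct_zero, ct_zero]
    · intro x hx; have := part_le β x hx; omega
    · intro x hx; have := part_le α x hx; omega

theorem coeff_FF_part {k : ℕ} (hk : k ≤ m) : PowerSeries.coeff (k + m * (m - 1)) (FF m) =
    (m.factorial : RR (m*2)) * ∑ α : Nat.Partition k, alt (m*2) (expo m (cc m α.parts)) := by
  rw [coeff_FF]
  have h := Finset.sum_of_injOn (s := (univ : Finset (Equiv.Perm (Fin m) × Nat.Partition k)))
    (t := finsuppAntidiag (univ : Finset (Fin m)) (k + m * (m - 1)))
    (f := fun p => alt (m*2) (expo m (cc m p.2.parts)))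
    (g := fun c => alt (m*2) (expo m c))
    (fun p => Finsupp.equivFunOnFinite.symm (cc m p.2.parts ∘ p.1)) ?_ ?_ ?_ ?_
  · rw [← h, Fintype.sum_prod_type]
    simp [Fintype.card_perm]
  · rintro ⟨σ, α⟩ _ ⟨τ, β⟩ _ h
    have := Finsupp.equivFunOnFinite.symm.injective h
    obtain ⟨h1, h2⟩ := cc_perm_inj m hk σ τ α β this
    rw [h1, h2]
  · rintro ⟨σ, α⟩ _
    simp only [Finset.mem_coe]
    rw [mem_finsuppAntidiag]
    refine ⟨?_, subset_univ _⟩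
    have := Equiv.sum_comp σ (cc m α.parts)
    rw [sum_cc m hk α] at this
    simpa using this
  · intro c hc hn
    by_contra h0
    rw [mem_finsuppAntidiag] at hc
    obtain ⟨σ, α, hα⟩ := exists_sorted m c hc.1 h0
    apply hn
    refine ⟨(σ, α), by simp, ?_⟩
    simp only [hα]
    ext1 x
    simp
  · rintro ⟨σ, α⟩ _
    exact (alt_expo_perm m _ σ).symm

theorem alt_delta_ne (N : ℕ) : alt N (fun j => N - 1 - j) ≠ 0 := by
  have h : alt N (fun j => N - 1 - j) =
      ((Matrix.vandermonde (fun i : Fin N => (X i : RR N))).submatrix id Fin.revPerm).det := by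
    rw [alt]
    congr 1
    ext1 i j
    simp only [Matrix.of_apply, Matrix.submatrix_apply, id, Matrix.vandermonde_apply,
      Fin.revPerm_apply, Fin.val_rev]
    congr 1
    omega
  rw [h, Matrix.det_permute']
  refine mul_ne_zero ?_ (Matrix.det_vandermonde_ne_zero_iff.mpr (X_injective))
  rcases Int.units_eq_one_or (Equiv.Perm.sign (Fin.revPerm : Equiv.Perm (Fin N))) with h | h <;>
    simp [h]

theorem main_phi (k : ℕ) (hk : k ≤ m) : phi (m*2) (pleth (hh k) (ee 2)) =
    phi (m*2) (∑ α : Nat.Partition k, schur (conj (double α.parts))) := by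
  rw [phi_pleth]
  have h1 := FF_main m k
  have h0 := coeff_FF_part m (Nat.zero_le m)
  rw [zero_add] at h0
  rw [coeff_FF_part m hk, h0] at h1
  simp only [← phi_schur m hk, ← phi_schur m (Nat.zero_le m)] at h1
  have e0 : ∀ α : Nat.Partition 0, schur (conj (double α.parts)) = 1 := by
    intro α
    have : α.parts = 0 := by
      rw [Subsingleton.elim α default]; rfl
    have h2 : conj (double 0) = 0 := by simp [conj, double]
    rw [this, h2, schur]
    haveI : IsEmpty (Fin (Multiset.card (0 : Multiset ℕ))) := by
      rw [Multiset.card_zero]; infer_instance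
    exact Matrix.det_isEmpty
  simp only [e0, map_one, one_mul, Finset.sum_const, Finset.card_univ, Fintype.card_unique, one_smul] at h1
  rw [← Finset.sum_mul, ← map_sum] at h1
  have hne := alt_delta_ne (m*2)
  have hf : (m.factorial : RR (m*2)) ≠ 0 := Nat.cast_ne_zero.mpr (Nat.factorial_ne_zero m)
  apply mul_left_cancel₀ (mul_ne_zero hf hne)
  rw [← h1]
  ring

end HK6

/-- `h_k ∘ e₂ = ∑_{α ⊢ k} s_{(2α)'}`. -/
theorem hk_pleth_e2 (k : ℕ) :
    pleth (hh k) (ee 2) = ∑ α : Nat.Partition k, schur (conj (double α.parts)) := by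
  rw [← sub_eq_zero]
  set f := pleth (hh k) (ee 2) - ∑ α : Nat.Partition k, schur (conj (double α.parts)) with hf
  let m := k + f.vars.sup id + 1
  refine phi_inj (m*2) f ?_ ?_
  · intro i hi
    have : id i ≤ f.vars.sup id := Finset.le_sup hi
    simp only [id] at this
    omega
  · rw [hf, map_sub, main_phi m k (by omega), sub_self]
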